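/- Let C be a triangle collection with m(C) < 15/8 such that Maker has a winning strategy in the unbiased T_C-tournament game on C, but Maker has no winning strategy in the unbiased T_C-tournament game on any triangle collection C' that is a proper subgraph of C. Then: (a) 5 ≤ v(C) ≤ 7; (b) e(C) = 2·v(C) − 1; (c) the minimum degree of C is at least 3; and (d) C is not basic. -/

import Mathlib

namespace TournamentGame

variable {V : Type*} [DecidableEq V]

/-- The underlying undirected edges of a set of oriented edges. -/
def undirect (M : Finset (V × V)) : Finset (Sym2 V) :=
  M.image fun p => s(p.1, p.2)

/-- `MakerWin X F b M B` : in the (1:b) Maker-Breaker game on board `X`, with Maker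
having claimed `M`, Breaker having claimed `B`, and Maker to move, Maker has a strategy
to claim all edges of some winning set (i.e. reach a position with `F` on her edges). -/
inductive MakerWin (X : Finset (Sym2 V)) (F : Finset (Sym2 V) → Prop) (b : ℕ) :
    Finset (Sym2 V) → Finset (Sym2 V) → Prop
  | win (M B : Finset (Sym2 V)) : F M → MakerWin X F b M B
  | move (M B : Finset (Sym2 V)) (e : Sym2 V) (heX : e ∈ X) (hefree : e ∉ M ∪ B)
      (h : ∀ B' : Finset (Sym2 V), B' ⊆ X \ (insert e M ∪ B) →
        B'.card = min b (X \ (insert e M ∪ B)).card →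
        MakerWin X F b (insert e M) (B ∪ B')) :
      MakerWin X F b M B

/-- `BreakerBlock X F b M B` : Maker to move; Breaker has a strategy ensuring that `F`
never holds on Maker's edge set. -/
inductive BreakerBlock (X : Finset (Sym2 V)) (F : Finset (Sym2 V) → Prop) (b : ℕ) :
    Finset (Sym2 V) → Finset (Sym2 V) → Prop
  | step (M B : Finset (Sym2 V)) (hF : ¬ F M) (resp : Sym2 V → Finset (Sym2 V))
      (hsub : ∀ e ∈ X, e ∉ M ∪ B → resp e ⊆ X \ (insert e M ∪ B))
      (hcard : ∀ e ∈ X, e ∉ M ∪ B → (resp e).card = min b (X \ (insert e M ∪ B)).card)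
      (h : ∀ e ∈ X, e ∉ M ∪ B → BreakerBlock X F b (insert e M) (B ∪ resp e)) :
      BreakerBlock X F b M B

/-- Oriented (tournament-game) version of `MakerWin`: Maker claims an edge together with
an orientation; her position is a set of oriented edges. -/
inductive OMakerWin (X : Finset (Sym2 V)) (F : Finset (V × V) → Prop) (b : ℕ) :
    Finset (V × V) → Finset (Sym2 V) → Prop
  | win (M : Finset (V × V)) (B : Finset (Sym2 V)) : F M → OMakerWin X F b M B
  | move (M : Finset (V × V)) (B : Finset (Sym2 V)) (x y : V)
      (heX : s(x, y) ∈ X) (hefree : s(x, y) ∉ undirect M ∪ B)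
      (h : ∀ B' : Finset (Sym2 V), B' ⊆ X \ (insert s(x, y) (undirect M) ∪ B) →
        B'.card = min b (X \ (insert s(x, y) (undirect M) ∪ B)).card →
        OMakerWin X F b (insert (x, y) M) (B ∪ B')) :
      OMakerWin X F b M B

/-- Oriented version of `BreakerBlock`. -/
inductive OBreakerBlock (X : Finset (Sym2 V)) (F : Finset (V × V) → Prop) (b : ℕ) :
    Finset (V × V) → Finset (Sym2 V) → Prop
  | step (M : Finset (V × V)) (B : Finset (Sym2 V)) (hF : ¬ F M)
      (resp : V → V → Finset (Sym2 V))
      (hsub : ∀ x y : V, s(x, y) ∈ X → s(x, y) ∉ undirect M ∪ B →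
        resp x y ⊆ X \ (insert s(x, y) (undirect M) ∪ B))
      (hcard : ∀ x y : V, s(x, y) ∈ X → s(x, y) ∉ undirect M ∪ B →
        (resp x y).card = min b (X \ (insert s(x, y) (undirect M) ∪ B)).card)
      (h : ∀ x y : V, s(x, y) ∈ X → s(x, y) ∉ undirect M ∪ B →
        OBreakerBlock X F b (insert (x, y) M) (B ∪ resp x y)) :
      OBreakerBlock X F b M B

/-- Position with Breaker to move, in the unoriented game: Breaker can respond and
then keep blocking forever. -/
def BreakerTurn (X : Finset (Sym2 V)) (F : Finset (Sym2 V) → Prop) (b : ℕ)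
    (M B : Finset (Sym2 V)) : Prop :=
  ¬ F M ∧ ∃ B' : Finset (Sym2 V), B' ⊆ X \ (M ∪ B) ∧
    B'.card = min b (X \ (M ∪ B)).card ∧ BreakerBlock X F b M (B ∪ B')

/-- Position with Breaker to move, in the oriented game. -/
def OBreakerTurn (X : Finset (Sym2 V)) (F : Finset (V × V) → Prop) (b : ℕ)
    (M : Finset (V × V)) (B : Finset (Sym2 V)) : Prop :=
  ¬ F M ∧ ∃ B' : Finset (Sym2 V), B' ⊆ X \ (undirect M ∪ B) ∧
    B'.card = min b (X \ (undirect M ∪ B)).card ∧ OBreakerBlock X F b M (B ∪ B')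

/-- Winning sets of the triangle game. -/
def HasTriangle (M : Finset (Sym2 V)) : Prop :=
  ∃ x y z : V, x ≠ y ∧ y ≠ z ∧ x ≠ z ∧ s(x, y) ∈ M ∧ s(y, z) ∈ M ∧ s(x, z) ∈ M

/-- Maker's oriented edges contain a cyclic (directed) triangle. -/
def HasCyclicTriangle (M : Finset (V × V)) : Prop :=
  ∃ x y z : V, x ≠ y ∧ y ≠ z ∧ x ≠ z ∧ (x, y) ∈ M ∧ (y, z) ∈ M ∧ (z, x) ∈ M

/-- Maker's oriented edges contain an acyclic (transitive) triangle. -/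
def HasAcyclicTriangle (M : Finset (V × V)) : Prop :=
  ∃ x y z : V, x ≠ y ∧ y ≠ z ∧ x ≠ z ∧ (x, y) ∈ M ∧ (y, z) ∈ M ∧ (x, z) ∈ M

/-- A tournament on `Fin k`, given by its arc relation. -/
def IsTournament {k : ℕ} (T : Fin k → Fin k → Prop) : Prop :=
  (∀ i, ¬ T i i) ∧ ∀ i j : Fin k, i ≠ j → (T i j ↔ ¬ T j i)

/-- Maker's oriented edges contain a copy of the tournament `T`. -/
def HasTCopy {k : ℕ} (T : Fin k → Fin k → Prop) (M : Finset (V × V)) : Prop :=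
  ∃ f : Fin k → V, Function.Injective f ∧ ∀ i j : Fin k, T i j → (f i, f j) ∈ M

/-- The edge set of the complete graph `K_n`. -/
def completeEdges (n : ℕ) : Finset (Sym2 (Fin n)) :=
  Finset.univ.filter fun e => ¬ e.IsDiag

/-- The edge set of the Turán graph `T_{n,k}` : classes are residues mod `k`. -/
def turanEdges (n k : ℕ) : Finset (Sym2 (Fin n)) :=
  Finset.univ.filter fun e => ¬ (e.map fun v : Fin n => v.val % k).IsDiag

/-- `A` contains a good copy of `K_k` (all vertices in distinct classes of `T_{n,k}`). -/
def GoodCopy (n k : ℕ) (A : Finset (Sym2 (Fin n))) : Prop :=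
  ∃ f : Fin k → Fin n, Function.Injective f ∧
    (∀ i j : Fin k, i ≠ j → (f i).val % k ≠ (f j).val % k) ∧
    (∀ i j : Fin k, i ≠ j → s(f i, f j) ∈ A)

open Classical in
/-- Probability that a `p`-random subset `A` of `E` (each element kept independently with
probability `p`) satisfies `P`. This is the model `G(E, p)`. -/
noncomputable def edgeProb {α : Type*} [DecidableEq α] (E : Finset α) (p : ℝ)
    (P : Finset α → Prop) : ℝ :=
  ∑ A ∈ E.powerset, if P A then p ^ A.card * (1 - p) ^ (E.card - A.card) else 0

open Classical in
/-- Probability that a uniformly random `M`-element subset of `E` satisfies `P`.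
This is the model `G(E, M)`. -/
noncomputable def uniformProb {α : Type*} [DecidableEq α] (E : Finset α) (M : ℕ)
    (P : Finset α → Prop) : ℝ :=
  ((E.powerset.filter fun A => A.card = M ∧ P A).card : ℝ) /
    ((E.powerset.filter fun A => A.card = M).card : ℝ)

/-- The three edges of a triangle on `x`, `y`, `z`. -/
def triEdges (x y z : V) : Finset (Sym2 V) := {s(x, y), s(y, z), s(x, z)}

/-- `x`, `y`, `z` form a triangle of the graph with edge set `A`. -/
def IsTriangleIn (A : Finset (Sym2 V)) (x y z : V) : Prop :=
  x ≠ y ∧ y ≠ z ∧ x ≠ z ∧ s(x, y) ∈ A ∧ s(y, z) ∈ A ∧ s(x, z) ∈ A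

/-- The triangles of `A`, each recorded as its set of three edges: the vertex set of `T_A`. -/
def TriSets (A : Finset (Sym2 V)) : Set (Finset (Sym2 V)) :=
  {t | ∃ x y z : V, IsTriangleIn A x y z ∧ t = triEdges x y z}

/-- `C` is a triangle collection: every edge lies in a triangle and the graph `T_C` of
triangles (adjacent iff sharing an edge) is connected. -/
def IsTriangleCollection (C : Finset (Sym2 V)) : Prop :=
  (∀ e ∈ C, ∃ x y z : V, IsTriangleIn C x y z ∧ e ∈ triEdges x y z) ∧
  ∀ t ∈ TriSets C, ∀ t' ∈ TriSets C,
    Relation.ReflTransGen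
      (fun a b => a ∈ TriSets C ∧ b ∈ TriSets C ∧ (a ∩ b).Nonempty) t t'

/-- Adjacency of `K₃⁺`: a triangle on `{0,1,2}` with a pendant edge `{2,3}`. -/
def K3plusAdj (a b : Fin 4) : Prop :=
  (a.val < 3 ∧ b.val < 3 ∧ a ≠ b) ∨ (a.val = 2 ∧ b.val = 3) ∨ (a.val = 3 ∧ b.val = 2)

/-- Adjacency of the path on `Fin m`. -/
def pathAdj {m : ℕ} (a b : Fin m) : Prop := a.val + 1 = b.val ∨ b.val + 1 = a.val

/-- `C` is very basic: `T_C` is (isomorphic to) a subgraph of `K₃⁺` or of a path `P_m`. -/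
def VeryBasic (C : Finset (Sym2 V)) : Prop :=
  (∃ φ : TriSets C → Fin 4, Function.Injective φ ∧
    ∀ t t' : TriSets C, t ≠ t' → ((t : Finset (Sym2 V)) ∩ (t' : Finset (Sym2 V))).Nonempty →
      K3plusAdj (φ t) (φ t')) ∨
  (∃ m : ℕ, ∃ φ : TriSets C → Fin m, Function.Injective φ ∧
    ∀ t t' : TriSets C, t ≠ t' → ((t : Finset (Sym2 V)) ∩ (t' : Finset (Sym2 V))).Nonempty →
      pathAdj (φ t) (φ t'))

/-- `C` is basic: there are distinct edges `e₁, e₂` with `C - eᵢ` very basic for both. -/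
def Basic (C : Finset (Sym2 V)) : Prop :=
  ∃ e₁ ∈ C, ∃ e₂ ∈ C, e₁ ≠ e₂ ∧ VeryBasic (C.erase e₁) ∧ VeryBasic (C.erase e₂)

open Classical in
/-- The set of non-isolated vertices of the graph with edge set `C`. -/
noncomputable def support [Fintype V] (C : Finset (Sym2 V)) : Finset V :=
  Finset.univ.filter fun v => ∃ e ∈ C, v ∈ e

open Classical in
/-- Degree of `v` in the graph with edge set `C`. -/
noncomputable def degreeIn (C : Finset (Sym2 V)) (v : V) : ℕ :=
  (C.filter fun e => v ∈ e).card

/-- The maximum density `m(C) = max_{H ⊆ C} e(H)/v(H)` is (strictly) less than `r`. -/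
def MaxDensityLt [Fintype V] (C : Finset (Sym2 V)) (r : ℝ) : Prop :=
  ∀ D ⊆ C, D.Nonempty → (D.card : ℝ) / ((support D).card : ℝ) < r

/-- The edge set of the `k`-wheel: a cycle on `{0, …, k-1} ⊆ Fin (k+1)` together with
all edges to the center, the vertex `k`. -/
def wheelEdges (k : ℕ) : Finset (Sym2 (Fin (k + 1))) :=
  ((Finset.univ : Finset (Fin k)).image fun i =>
    s((⟨i.val, by have := i.2; omega⟩ : Fin (k + 1)),
      (⟨(i.val + 1) % k, by have := i.2; exact Nat.lt_succ_of_lt (Nat.mod_lt _ (by omega))⟩ :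
        Fin (k + 1)))) ∪
  ((Finset.univ : Finset (Fin k)).image fun i =>
    s((⟨i.val, by have := i.2; omega⟩ : Fin (k + 1)), (Fin.last k)))

/-- There is a partial matching of elements, leaving `f` unmatched, such that every set in `𝒯`
contains a matched pair. The matching is encoded as an involution. -/
def Paired {E : Type*} (𝒯 : Set (Finset E)) (f : E) : Prop :=
  ∃ σ : E → E, σ.Involutive ∧ σ f = f ∧ ∀ t ∈ 𝒯, ∃ e ∈ t, σ e ∈ t ∧ σ e ≠ e

/-- Whichever element `f` Maker claims first, Breaker can answer with some `g` so that the sets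
of `𝒯` avoiding `g` are blocked by a pairing leaving `f` unmatched. -/
def Answerable {E : Type*} (𝒯 : Set (Finset E)) : Prop :=
  ∀ f, ∃ g ≠ f, Paired {t ∈ 𝒯 | g ∉ t} f

section Pairing

variable {E : Type*} {𝒯 𝒯' : Set (Finset E)} {t : Finset E} {f : E}

lemma Paired.mono (h : Paired 𝒯 f) (h' : 𝒯' ⊆ 𝒯) : Paired 𝒯' f := by
  obtain ⟨σ, h1, h2, h3⟩ := h
  exact ⟨σ, h1, h2, fun t ht => h3 t (h' ht)⟩

lemma Answerable.mono (h : Answerable 𝒯) (h' : 𝒯' ⊆ 𝒯) : Answerable 𝒯' := by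
  intro f
  obtain ⟨g, hg, hp⟩ := h f
  exact ⟨g, hg, hp.mono fun t ht => ⟨h' ht.1, ht.2⟩⟩

lemma Answerable.of_paired [Nontrivial E] (h : ∀ f, Paired 𝒯 f) : Answerable 𝒯 := by
  intro f
  obtain ⟨g, hg⟩ := exists_ne f
  exact ⟨g, hg, (h f).mono fun t ht => ht.1⟩

lemma Paired.exists_fixing_outside (h : Paired 𝒯 f) :
    ∃ σ : E → E, σ.Involutive ∧ σ f = f ∧ (∀ e, (∀ t ∈ 𝒯, e ∉ t) → σ e = e) ∧
      ∀ t ∈ 𝒯, ∃ e ∈ t, σ e ∈ t ∧ σ e ≠ e := by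
  classical
  obtain ⟨σ, h1, h2, h3⟩ := h
  refine ⟨fun e => if ∃ t ∈ 𝒯, e ∈ t ∧ σ e ∈ t then σ e else e, ?_, ?_, ?_, ?_⟩
  · intro e
    by_cases h : ∃ t ∈ 𝒯, e ∈ t ∧ σ e ∈ t
    · obtain ⟨t, ht, he, he'⟩ := h
      have h5 : ∃ t ∈ 𝒯, e ∈ t ∧ σ e ∈ t := ⟨t, ht, he, he'⟩
      have h6 : ∃ t ∈ 𝒯, σ e ∈ t ∧ e ∈ t := ⟨t, ht, he', he⟩
      simp [h5, h6, h1 e]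
    · simp [h]
  · simp [h2]
  · grind
  · intro t ht
    obtain ⟨e, he, he', hne⟩ := h3 t ht
    have : ∃ t ∈ 𝒯, e ∈ t ∧ σ e ∈ t := ⟨t, ht, he, he'⟩
    exact ⟨e, he, by simpa [this] using he', by simpa [this] using hne⟩

lemma exists_involutive_extend {σ : E → E} (hσ : σ.Involutive) {a b : E} (ha : σ a = a)
    (hb : σ b = b) :
    ∃ τ : E → E, τ.Involutive ∧ τ a = b ∧ τ b = a ∧ ∀ e, e ≠ a → e ≠ b → τ e = σ e := by
  classical
  refine ⟨fun e => if e = a then b else if e = b then a else σ e, ?_, ?_, ?_, ?_⟩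
  · intro e
    have := hσ e
    grind
  all_goals grind

lemma exists_involutive_remove {σ : E → E} (hσ : σ.Involutive) (a : E) :
    ∃ τ : E → E, τ.Involutive ∧ τ a = a ∧ τ (σ a) = σ a ∧
      ∀ e, e ≠ a → e ≠ σ a → τ e = σ e := by
  classical
  refine ⟨fun e => if e = a ∨ e = σ a then e else σ e, ?_, ?_, ?_, ?_⟩
  · intro e
    have := hσ e
    have := hσ a
    grind
  all_goals grind

lemma Paired.insert_of_fixed {σ : E → E} (hσ : σ.Involutive)
    (h : ∀ t ∈ 𝒯, ∃ e ∈ t, σ e ∈ t ∧ σ e ≠ e) {a b : E} (ha : a ∈ t) (hb : b ∈ t)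
    (hab : a ≠ b) (hσa : σ a = a) (hσb : σ b = b) (hf : σ f = f) (hfa : f ≠ a) (hfb : f ≠ b) :
    Paired (insert t 𝒯) f := by
  obtain ⟨τ, h1, h2, h3, h4⟩ := exists_involutive_extend hσ hσa hσb
  refine ⟨τ, h1, by rw [h4 f hfa hfb, hf], ?_⟩
  rintro s (rfl | hs)
  · exact ⟨a, ha, by rwa [h2], by rw [h2]; exact hab.symm⟩
  · obtain ⟨e, he, he', hne⟩ := h s hs
    have h5 : τ e = σ e := h4 e (by grind) (by grind)
    exact ⟨e, he, by rwa [h5], by rwa [h5]⟩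

/-- Adding a three-element set that meets the union of `𝒯` in at most one element. -/
lemma Paired.insert_leaf (ht : t.card = 3)
    (hleaf : ∀ e ∈ t, ∀ e' ∈ t, (∃ s ∈ 𝒯, e ∈ s) → (∃ s ∈ 𝒯, e' ∈ s) → e = e')
    (f : E) : ∃ h, (h = f ∨ (f ∈ t ∧ h ∈ t ∧ ∃ s ∈ 𝒯, h ∈ s)) ∧
      ∀ 𝒯' ⊆ 𝒯, Paired 𝒯' h → Paired (insert t 𝒯') f := by
  classical
  obtain ⟨x, y, z, hxy, hxz, hyz, rfl⟩ := Finset.card_eq_three.1 ht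
  have key : ∀ h a b, a ∈ ({x, y, z} : Finset E) → b ∈ ({x, y, z} : Finset E) → a ≠ b →
      (h = a ∨ ∀ s ∈ 𝒯, a ∉ s) → (∀ s ∈ 𝒯, b ∉ s) → (h = f ∨ ∀ s ∈ 𝒯, f ∉ s) →
      f ≠ a → f ≠ b → ∀ 𝒯' ⊆ 𝒯, Paired 𝒯' h → Paired (insert {x, y, z} 𝒯') f := by
    intro h a b ha hb hab h1 h2 h3 h4 h5 𝒯' hsub hP
    obtain ⟨σ, hσ, hσh, hout, hin⟩ := hP.exists_fixing_outside
    refine Paired.insert_of_fixed hσ hin ha hb hab ?_ ?_ ?_ h4 h5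
    · rcases h1 with rfl | h1
      · exact hσh
      · exact hout _ fun s hs => h1 s (hsub hs)
    · exact hout _ fun s hs => h2 s (hsub hs)
    · rcases h3 with rfl | h3
      · exact hσh
      · exact hout _ fun s hs => h3 s (hsub hs)
  have hfresh : ∀ a b, a ∈ ({x, y, z} : Finset E) → b ∈ ({x, y, z} : Finset E) → a ≠ b →
      (∃ s ∈ 𝒯, a ∈ s) → ∀ s ∈ 𝒯, b ∉ s := by
    intro a b ha hb hab h s hs hbs
    exact hab (hleaf a ha b hb h ⟨s, hs, hbs⟩)
  have main : ∀ u v w, ({u, v, w} : Finset E) = {x, y, z} → u ≠ v → u ≠ w → v ≠ w →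
      (∀ s ∈ 𝒯, v ∉ s) → (∀ s ∈ 𝒯, w ∉ s) →
      ∃ h, (h = f ∨ (f ∈ ({x, y, z} : Finset E) ∧ h ∈ ({x, y, z} : Finset E) ∧
        ∃ s ∈ 𝒯, h ∈ s)) ∧ ∀ 𝒯' ⊆ 𝒯, Paired 𝒯' h → Paired (insert {x, y, z} 𝒯') f := by
    intro u v w he huv huw hvw hv hw
    have mu : u ∈ ({x, y, z} : Finset E) := by simp [← he]
    have mv : v ∈ ({x, y, z} : Finset E) := by simp [← he]
    have mw : w ∈ ({x, y, z} : Finset E) := by simp [← he]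
    by_cases hfv : f = v
    · subst hfv
      by_cases hu : ∃ s ∈ 𝒯, u ∈ s
      · exact ⟨u, .inr ⟨mv, mu, hu⟩, key u u w mu mw huw (.inl rfl) hw (.inr hv) huv.symm hvw⟩
      · push Not at hu
        exact ⟨f, .inl rfl, key f u w mu mw huw (.inr hu) hw (.inl rfl) huv.symm hvw⟩
    by_cases hfw : f = w
    · subst hfw
      by_cases hu : ∃ s ∈ 𝒯, u ∈ s
      · exact ⟨u, .inr ⟨mw, mu, hu⟩,
          key u u v mu mv huv (.inl rfl) hv (.inr hw) huw.symm hvw.symm⟩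
      · push Not at hu
        exact ⟨f, .inl rfl, key f u v mu mv huv (.inr hu) hv (.inl rfl) huw.symm hvw.symm⟩
    exact ⟨f, .inl rfl, key f v w mv mw hvw (.inr hv) hw (.inl rfl) hfv hfw⟩
  by_cases hx : ∃ s ∈ 𝒯, x ∈ s
  · exact main x y z rfl hxy hxz hyz (hfresh x y (by simp) (by simp) hxy hx)
      (hfresh x z (by simp) (by simp) hxz hx)
  by_cases hy : ∃ s ∈ 𝒯, y ∈ s
  · exact main y x z (by grind) hxy.symm hyz hxz (hfresh y x (by simp) (by simp) hxy.symm hy)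
      (hfresh y z (by simp) (by simp) hyz hy)
  push Not at hx hy
  exact main z x y (by grind) hxz.symm hyz.symm hxy hx hy

lemma forall_paired_insert_leaf (h : ∀ f, Paired 𝒯 f) (ht : t.card = 3)
    (hleaf : ∀ e ∈ t, ∀ e' ∈ t, (∃ s ∈ 𝒯, e ∈ s) → (∃ s ∈ 𝒯, e' ∈ s) → e = e') :
    ∀ f, Paired (insert t 𝒯) f := by
  intro f
  obtain ⟨g, -, hg⟩ := Paired.insert_leaf ht hleaf f
  exact hg 𝒯 subset_rfl (h g)

lemma Answerable.insert_leaf (h : Answerable 𝒯) (ht : t.card = 3)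
    (hleaf : ∀ e ∈ t, ∀ e' ∈ t, (∃ s ∈ 𝒯, e ∈ s) → (∃ s ∈ 𝒯, e' ∈ s) → e = e') :
    Answerable (insert t 𝒯) := by
  intro f
  obtain ⟨k, hk, hins⟩ := Paired.insert_leaf ht hleaf f
  obtain ⟨g, hgk, hP⟩ := h k
  by_cases hgf : g = f
  · subst hgf
    obtain ⟨hgt, hkt, hks⟩ := hk.resolve_left hgk.symm
    obtain ⟨g', hg', hne⟩ := Finset.exists_mem_ne (by omega : 1 < t.card) g
    refine ⟨g', hne, (hins 𝒯 subset_rfl (hP.mono fun s hs => ⟨hs, fun hgs => ?_⟩)).mono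
      fun s hs => hs.1⟩
    exact hgk (hleaf g hgt k hkt ⟨s, hs, hgs⟩ hks)
  · refine ⟨g, hgf, (hins _ (fun s hs => hs.1) hP).mono ?_⟩
    rintro s ⟨rfl | hs, hgs⟩
    · exact .inl rfl
    · exact .inr ⟨hs, hgs⟩

end Pairing

section Game

lemma exists_response {α : Type*} [DecidableEq α] (S : Finset α) (g : α) :
    ∃ B ⊆ S, B.card = min 1 S.card ∧ (g ∈ S → g ∈ B) := by
  by_cases hg : g ∈ S
  · refine ⟨{g}, by simpa using hg, ?_, by simp⟩
    have := Finset.card_pos.2 ⟨g, hg⟩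
    rw [Finset.card_singleton]; omega
  · obtain ⟨B, hB, hc⟩ := Finset.exists_subset_card_eq (Nat.min_le_right 1 S.card)
    exact ⟨B, hB, hc, fun h => absurd h hg⟩

lemma undirect_insert (x y : V) (M : Finset (V × V)) :
    undirect (insert (x, y) M) = insert s(x, y) (undirect M) := by
  simp [undirect, Finset.image_insert]

lemma mk_mem_undirect {x y : V} {M : Finset (V × V)} (h : (x, y) ∈ M) :
    s(x, y) ∈ undirect M :=
  Finset.mem_image_of_mem (fun p : V × V => s(p.1, p.2)) h

lemma HasCyclicTriangle.exists_triSet {X : Finset (Sym2 V)} {M : Finset (V × V)}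
    (h : HasCyclicTriangle M) (hM : undirect M ⊆ X) : ∃ t ∈ TriSets X, t ⊆ undirect M := by
  obtain ⟨x, y, z, hxy, hyz, hxz, h1, h2, h3⟩ := h
  have h1 := mk_mem_undirect h1
  have h2 := mk_mem_undirect h2
  have h3 : s(x, z) ∈ undirect M := Sym2.eq_swap ▸ mk_mem_undirect h3
  refine ⟨_, ⟨x, y, z, ⟨hxy, hyz, hxz, hM h1, hM h2, hM h3⟩, rfl⟩, ?_⟩
  simp [triEdges, Finset.insert_subset_iff, h1, h2, h3]

lemma OMakerWin.false_of_pairing {X : Finset (Sym2 V)} {M : Finset (V × V)}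
    {B : Finset (Sym2 V)} (h : OMakerWin X HasCyclicTriangle 1 M B) (hM : undirect M ⊆ X)
    (hMB : Disjoint (undirect M) B) {σ : Sym2 V → Sym2 V} (hσ : σ.Involutive)
    (hpair : ∀ t ∈ TriSets X, (∃ e ∈ t, e ∈ B) ∨ ∃ e ∈ t, σ e ∈ t ∧ σ e ≠ e)
    (hresp : ∀ e ∈ undirect M, σ e ≠ e → σ e ∈ X → σ e ∈ B) : False := by
  induction h with
  | win M B hF =>
    obtain ⟨t, ht, hsub⟩ := hF.exists_triSet hM
    rcases hpair t ht with ⟨e, he, heB⟩ | ⟨e, he, he', hne⟩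
    · exact Finset.disjoint_left.1 hMB (hsub he) heB
    · exact Finset.disjoint_left.1 hMB (hsub he')
        (hresp e (hsub he) hne (hM (hsub he')))
  | move M B x y heX hefree h ih =>
    obtain ⟨B', hB', hc, hg⟩ := exists_response
      (X \ (insert s(x, y) (undirect M) ∪ B)) (σ s(x, y))
    have hdisj : ∀ e ∈ B', e ∈ X ∧ e ≠ s(x, y) ∧ e ∉ undirect M ∧ e ∉ B := by
      intro e he
      have := hB' he
      simp only [Finset.mem_sdiff, Finset.mem_union, Finset.mem_insert] at this
      tauto
    simp only [Finset.mem_union, not_or] at hefree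
    refine ih B' hB' hc ?_ ?_ ?_ ?_
    · rw [undirect_insert]
      exact Finset.insert_subset heX hM
    · rw [undirect_insert, Finset.disjoint_left]
      intro e he heB
      have := @Finset.disjoint_left _ (undirect M) B
      rcases Finset.mem_union.1 heB with h1 | h1 <;>
      rcases Finset.mem_insert.1 he with rfl | h2
      · exact hefree.2 h1
      · exact this.1 hMB h2 h1
      · exact (hdisj _ h1).2.1 rfl
      · exact (hdisj _ h1).2.2.1 h2
    · intro t ht
      rcases hpair t ht with ⟨e, he, heB⟩ | h1
      · exact .inl ⟨e, he, Finset.mem_union_left _ heB⟩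
      · exact .inr h1
    · rw [undirect_insert]
      intro e he hne heX'
      rcases Finset.mem_insert.1 he with rfl | h2
      · by_cases hB : σ s(x, y) ∈ B
        · exact Finset.mem_union_left _ hB
        · refine Finset.mem_union_right _ (hg ?_)
          simp only [Finset.mem_sdiff, Finset.mem_union, Finset.mem_insert, not_or]
          refine ⟨heX', ⟨hne, fun h3 => hefree.2 ?_⟩, hB⟩
          have := hresp _ h3 (by rw [hσ]; exact hne.symm) (by rwa [hσ])
          rwa [hσ] at this
      · exact Finset.mem_union_left _ (hresp e h2 hne heX')

lemma Answerable.not_oMakerWin {X : Finset (Sym2 V)} (h : Answerable (TriSets X)) :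
    ¬ OMakerWin X HasCyclicTriangle 1 ∅ ∅ := by
  rintro (⟨_, _, hF⟩ | ⟨_, _, x, y, heX, -, hwin⟩)
  · obtain ⟨x, y, z, -, -, -, h1, -⟩ := hF
    simp at h1
  obtain ⟨g, hg, σ, hσ, hσf, hpair⟩ := h s(x, y)
  obtain ⟨B', hB', hc, hgB⟩ := exists_response
    (X \ (insert s(x, y) (undirect ∅) ∪ ∅)) g
  have hu : undirect (insert (x, y) (∅ : Finset (V × V))) = {s(x, y)} := by simp [undirect]
  refine (hwin B' hB' hc).false_of_pairing ?_ ?_ hσ ?_ ?_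
  · rw [hu]; simpa using heX
  · rw [hu]
    simp only [Finset.disjoint_singleton_left, Finset.empty_union]
    intro h1
    simpa using hB' h1
  · intro t ht
    by_cases hgt : g ∈ t
    · refine .inl ⟨g, hgt, ?_⟩
      have hgX : g ∈ X := by
        obtain ⟨a, b, c, ⟨-, -, -, h1, h2, h3⟩, rfl⟩ := ht
        simp only [triEdges, Finset.mem_insert, Finset.mem_singleton] at hgt
        rcases hgt with rfl | rfl | rfl <;> assumption
      rw [Finset.empty_union]
      apply hgB
      simp [undirect, hgX, hg]
    · exact .inr (hpair t ⟨ht, hgt⟩)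
  · rw [hu]
    intro e he hne
    rw [Finset.mem_singleton] at he
    subst he
    exact absurd hσf hne

/-- Maker's win on `C` restricts to a win on `D` when `C \ D` consists of two edges `p`, `q`
which lie in the same triangles of `C`. -/
lemma OMakerWin.restrict {C D : Finset (Sym2 V)} {p q : Sym2 V}
    (hC : C = insert p (insert q D)) (hpq : p ≠ q) (hpD : p ∉ D) (hqD : q ∉ D)
    (htri : ∀ t ∈ TriSets C, p ∈ t ↔ q ∈ t) {M : Finset (V × V)} {B : Finset (Sym2 V)}
    (h : OMakerWin C HasCyclicTriangle 1 M B) (hM : undirect M ⊆ C)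
    (hMB : Disjoint (undirect M) B) (hp : p ∈ undirect M → q ∈ B)
    (hq : q ∈ undirect M → p ∈ B) {B₀ : Finset (Sym2 V)} (hB₀ : B₀ ⊆ B)
    {M₀ : Finset (V × V)} (hM₀ : M₀ = M.filter fun a => s(a.1, a.2) ∈ D) :
    OMakerWin D HasCyclicTriangle 1 M₀ B₀ := by
  induction h generalizing B₀ M₀ with
  | win M B hF =>
    obtain ⟨x, y, z, hxy, hyz, hxz, h1, h2, h3⟩ := hF
    have u1 := mk_mem_undirect h1
    have u2 := mk_mem_undirect h2
    have u3 := mk_mem_undirect h3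
    have hsub : ∀ e ∈ triEdges x y z, e ∈ undirect M := by
      intro e he
      simp only [triEdges, Finset.mem_insert, Finset.mem_singleton] at he
      rcases he with rfl | rfl | rfl
      exacts [u1, u2, Sym2.eq_swap ▸ u3]
    have ht := htri (triEdges x y z) ⟨x, y, z, ⟨hxy, hyz, hxz, hM u1, hM u2,
      Sym2.eq_swap ▸ hM u3⟩, rfl⟩
    have hnp : p ∉ triEdges x y z := fun h4 =>
      Finset.disjoint_left.1 hMB (hsub q (ht.1 h4)) (hp (hsub p h4))
    have hD : ∀ e ∈ triEdges x y z, e ∈ D := by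
      intro e he
      have := hM (hsub e he)
      rw [hC, Finset.mem_insert, Finset.mem_insert] at this
      rcases this with rfl | rfl | h5
      · exact absurd he hnp
      · exact absurd (ht.2 he) hnp
      · exact h5
    refine .win _ _ ⟨x, y, z, hxy, hyz, hxz, ?_, ?_, ?_⟩ <;> rw [hM₀, Finset.mem_filter]
    · exact ⟨h1, hD _ (by simp [triEdges])⟩
    · exact ⟨h2, hD _ (by simp [triEdges])⟩
    · exact ⟨h3, hD _ (by simp [triEdges, Sym2.eq_swap (a := z)])⟩
  | move M B x y heX hefree h ih =>
    have hefree' : s(x, y) ∉ undirect M ∧ s(x, y) ∉ B := by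
      simpa only [Finset.mem_union, not_or] using hefree
    have hu₀ : ∀ e, e ∈ undirect M₀ ↔ e ∈ undirect M ∧ e ∈ D := by
      intro e
      simp only [hM₀, undirect, Finset.mem_image, Finset.mem_filter]
      constructor
      · rintro ⟨a, ⟨ha, ha'⟩, rfl⟩
        exact ⟨⟨a, ha, rfl⟩, ha'⟩
      · rintro ⟨⟨a, ha, rfl⟩, ha'⟩
        exact ⟨a, ⟨ha, ha'⟩, rfl⟩
    have hMins : undirect (insert (x, y) M) ⊆ C := by
      rw [undirect_insert]
      exact Finset.insert_subset heX hM
    have hdisj : ∀ R ⊆ C \ (insert s(x, y) (undirect M) ∪ B),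
        Disjoint (undirect (insert (x, y) M)) (B ∪ R) := by
      intro R hR
      rw [undirect_insert, Finset.disjoint_left]
      intro e he heB
      rcases Finset.mem_union.1 heB with h1 | h1
      · rcases Finset.mem_insert.1 he with rfl | h2
        · exact hefree'.2 h1
        · exact Finset.disjoint_left.1 hMB h2 h1
      · have := hR h1
        simp only [Finset.mem_sdiff, Finset.mem_union] at this
        tauto
    by_cases heD : s(x, y) ∈ D
    · have hep : p ≠ s(x, y) := by rintro rfl; exact hpD heD
      have heq : q ≠ s(x, y) := by rintro rfl; exact hqD heD
      refine .move _ _ x y heD ?_ ?_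
      · simp only [Finset.mem_union, hu₀, not_or]
        exact ⟨fun h1 => hefree'.1 h1.1, fun h1 => hefree'.2 (hB₀ h1)⟩
      · intro B'' hB'' hc''
        obtain ⟨g, hg⟩ : ∃ g, B'' ⊆ {g} := by
          have : Nonempty (Sym2 V) := ⟨p⟩
          exact Finset.card_le_one_iff_subset_singleton.1 (by omega)
        obtain ⟨R, hR, hRc, hgR⟩ := exists_response
          (C \ (insert s(x, y) (undirect M) ∪ B)) g
        refine ih R hR hRc hMins (hdisj R hR) ?_ ?_ ?_ ?_
        · rw [undirect_insert, Finset.mem_insert]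
          exact fun h1 => Finset.mem_union_left _ (hp (h1.resolve_left hep))
        · rw [undirect_insert, Finset.mem_insert]
          exact fun h1 => Finset.mem_union_left _ (hq (h1.resolve_left heq))
        · refine Finset.union_subset (hB₀.trans Finset.subset_union_left) fun e he => ?_
          obtain rfl := Finset.mem_singleton.1 (hg he)
          have h1 := hB'' he
          simp only [Finset.mem_sdiff, Finset.mem_union, Finset.mem_insert, hu₀] at h1
          by_cases h2 : e ∈ B
          · exact Finset.mem_union_left _ h2
          · refine Finset.mem_union_right _ (hgR ?_)
            simp only [Finset.mem_sdiff, Finset.mem_union, Finset.mem_insert]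
            have : e ∈ C := by simp [hC, h1.1]
            tauto
        · rw [Finset.filter_insert, if_pos heD, hM₀]
    · obtain ⟨r, hr⟩ : ∃ r, (s(x, y) = p ∧ r = q) ∨ (s(x, y) = q ∧ r = p) := by
        rw [hC, Finset.mem_insert, Finset.mem_insert] at heX
        rcases heX with h1 | h1 | h1
        · exact ⟨q, .inl ⟨h1, rfl⟩⟩
        · exact ⟨p, .inr ⟨h1, rfl⟩⟩
        · exact absurd h1 heD
      obtain ⟨R, hR, hRc, hrR⟩ := exists_response
        (C \ (insert s(x, y) (undirect M) ∪ B)) r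
      have hrB : r ∈ B ∪ R := by
        by_cases h2 : r ∈ B
        · exact Finset.mem_union_left _ h2
        · refine Finset.mem_union_right _ (hrR ?_)
          simp only [Finset.mem_sdiff, Finset.mem_union, Finset.mem_insert, not_or]
          rcases hr with ⟨h3, rfl⟩ | ⟨h3, rfl⟩
          · rw [h3] at hefree' ⊢
            exact ⟨by simp [hC], ⟨hpq.symm, fun h4 => hefree'.2 (hq h4)⟩, h2⟩
          · rw [h3] at hefree' ⊢
            exact ⟨by simp [hC], ⟨hpq, fun h4 => hefree'.2 (hp h4)⟩, h2⟩
      refine ih R hR hRc hMins (hdisj R hR) ?_ ?_ (hB₀.trans Finset.subset_union_left) ?_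
      · rw [undirect_insert, Finset.mem_insert]
        rintro (h1 | h1)
        · rcases hr with ⟨h3, rfl⟩ | ⟨h3, rfl⟩
          · exact hrB
          · exact absurd (h1.trans h3) hpq
        · exact Finset.mem_union_left _ (hp h1)
      · rw [undirect_insert, Finset.mem_insert]
        rintro (h1 | h1)
        · rcases hr with ⟨h3, rfl⟩ | ⟨h3, rfl⟩
          · exact absurd (h1.trans h3) hpq.symm
          · exact hrB
        · exact Finset.mem_union_left _ (hq h1)
      · rw [Finset.filter_insert, if_neg heD, hM₀]

end Game

section Triangles

variable {A A' H : Finset (Sym2 V)} {t t' : Finset (Sym2 V)}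

lemma mem_triEdges {x y z : V} {e : Sym2 V} :
    e ∈ triEdges x y z ↔ e = s(x, y) ∨ e = s(y, z) ∨ e = s(x, z) := by
  simp [triEdges]

lemma triEdges_rotate (x y z : V) : triEdges x y z = triEdges y z x := by
  ext e
  simp only [mem_triEdges, Sym2.eq_swap (a := z) (b := x), Sym2.eq_swap (a := y) (b := x)]
  tauto

lemma triEdges_swap (x y z : V) : triEdges x y z = triEdges y x z := by
  ext e
  simp only [mem_triEdges, Sym2.eq_swap (a := y) (b := x)]
  tauto

lemma card_triEdges {x y z : V} (hxy : x ≠ y) (hyz : y ≠ z) (hxz : x ≠ z) :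
    (triEdges x y z).card = 3 := by
  rw [triEdges, Finset.card_eq_three]
  refine ⟨_, _, _, ?_, ?_, ?_, rfl⟩ <;> simp <;> tauto

lemma IsTriangleIn.triEdges_subset {x y z : V} (h : IsTriangleIn A x y z) :
    triEdges x y z ⊆ A := by
  obtain ⟨-, -, -, h1, h2, h3⟩ := h
  simp [triEdges, Finset.insert_subset_iff, h1, h2, h3]

lemma IsTriangleIn.rotate {x y z : V} (h : IsTriangleIn A x y z) : IsTriangleIn A y z x := by
  obtain ⟨h1, h2, h3, h4, h5, h6⟩ := h
  exact ⟨h2, h3.symm, h1.symm, h5, Sym2.eq_swap ▸ h6, Sym2.eq_swap ▸ h4⟩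

lemma IsTriangleIn.swap {x y z : V} (h : IsTriangleIn A x y z) : IsTriangleIn A y x z := by
  obtain ⟨h1, h2, h3, h4, h5, h6⟩ := h
  exact ⟨h1.symm, h3, h2, Sym2.eq_swap ▸ h4, h6, h5⟩

lemma TriSets.subset (ht : t ∈ TriSets A) : t ⊆ A := by
  obtain ⟨x, y, z, h, rfl⟩ := ht
  exact h.triEdges_subset

lemma TriSets.card (ht : t ∈ TriSets A) : t.card = 3 := by
  obtain ⟨x, y, z, h, rfl⟩ := ht
  exact card_triEdges h.1 h.2.1 h.2.2.1

lemma TriSets.of_subset (ht : t ∈ TriSets A) (h : t ⊆ A') : t ∈ TriSets A' := by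
  obtain ⟨x, y, z, h1, rfl⟩ := ht
  exact ⟨x, y, z, ⟨h1.1, h1.2.1, h1.2.2.1, h (by simp [triEdges]), h (by simp [triEdges]),
    h (by simp [triEdges])⟩, rfl⟩

lemma TriSets.exists_apex {a b : V} (ht : t ∈ TriSets A) (h : s(a, b) ∈ t) :
    ∃ c, IsTriangleIn A a b c ∧ t = triEdges a b c := by
  obtain ⟨x, y, z, hA, rfl⟩ := ht
  have key : ∀ u v w, s(a, b) = s(u, v) → IsTriangleIn A u v w →
      ∃ c, IsTriangleIn A a b c ∧ triEdges u v w = triEdges a b c := by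
    intro u v w h1 h2
    rcases Sym2.eq_iff.1 h1 with ⟨rfl, rfl⟩ | ⟨rfl, rfl⟩
    · exact ⟨w, h2, rfl⟩
    · exact ⟨w, h2.swap, triEdges_swap _ _ _⟩
  rcases mem_triEdges.1 h with h | h | h
  · exact key x y z h hA
  · rw [triEdges_rotate]
    exact key y z x h hA.rotate
  · rw [← triEdges_rotate]
    exact key z x y (h.trans Sym2.eq_swap) hA.rotate.rotate

lemma TriSets.eq_of_common {e e' : Sym2 V} (ht : t ∈ TriSets A) (ht' : t' ∈ TriSets A')
    (hne : e ≠ e') (h1 : e ∈ t) (h2 : e' ∈ t) (h3 : e ∈ t') (h4 : e' ∈ t') : t = t' := by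
  induction e with | h a b =>
  obtain ⟨c, hc, rfl⟩ := TriSets.exists_apex ht h1
  obtain ⟨d, hd, rfl⟩ := TriSets.exists_apex ht' h3
  suffices c = d by rw [this]
  obtain ⟨p1, p2, p3, -⟩ := hc
  obtain ⟨-, p4, p5, -⟩ := hd
  rcases mem_triEdges.1 h2 with rfl | rfl | rfl
  · exact absurd rfl hne
  all_goals
    simp only [mem_triEdges, Sym2.eq_iff] at h4
    grind

lemma TriSets.exists_apex_of_mem {a b c : V} (ht : t ∈ TriSets A) (h1 : s(a, b) ∈ t)
    (h2 : s(a, c) ∈ t) (hbc : b ≠ c) : t = triEdges a b c ∧ IsTriangleIn A a b c := by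
  obtain ⟨d, hd, rfl⟩ := TriSets.exists_apex ht h1
  suffices c = d by rw [this]; exact ⟨rfl, hd⟩
  obtain ⟨p1, p2, p3, -⟩ := hd
  simp only [mem_triEdges, Sym2.eq_iff] at h2
  grind

lemma TriSets.exists_of_mem_vertex {w : V} {e : Sym2 V} (ht : t ∈ TriSets A) (he : e ∈ t)
    (hw : w ∈ e) : ∃ u v, IsTriangleIn A w u v ∧ t = triEdges w u v := by
  obtain ⟨u, rfl⟩ := hw
  obtain ⟨v, hv⟩ := TriSets.exists_apex ht he
  exact ⟨u, v, hv⟩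

/-- If `w` is a new vertex then attaching it to `a` and `b` creates at most one triangle. -/
lemma triSets_attach_subset {a b w : V} (hw : ∀ e ∈ H, w ∉ e) :
    TriSets (insert s(w, a) (insert s(w, b) H)) ⊆ insert (triEdges w a b) (TriSets H) := by
  intro t ht
  by_cases hsub : t ⊆ H
  · exact .inr (TriSets.of_subset ht hsub)
  left
  obtain ⟨e, he, heH⟩ := Finset.not_subset.1 hsub
  have hwe : w ∈ e := by
    have := TriSets.subset ht he
    rw [Finset.mem_insert, Finset.mem_insert] at this
    rcases this with rfl | rfl | h
    · simp
    · simp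
    · exact absurd h heH
  obtain ⟨u, v, ⟨h1, h2, h3, h4, -, h5⟩, rfl⟩ := TriSets.exists_of_mem_vertex ht he hwe
  have key : ∀ c, s(w, c) ∈ insert s(w, a) (insert s(w, b) H) → c = a ∨ c = b := by
    intro c hc
    rw [Finset.mem_insert, Finset.mem_insert] at hc
    rcases hc with h | h | h
    · exact .inl (Sym2.congr_right.1 h)
    · exact .inr (Sym2.congr_right.1 h)
    · exact absurd (Sym2.mem_mk_left _ _) (hw _ h)
  rcases key u h4 with rfl | rfl <;> rcases key v h5 with rfl | rfl
  · exact absurd rfl h2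
  · rfl
  · rw [triEdges_rotate, triEdges_rotate, triEdges_swap]
  · exact absurd rfl h2

lemma attach_leaf {a b w : V} (hw : ∀ e ∈ H, w ∉ e) :
    ∀ e ∈ triEdges w a b, ∀ e' ∈ triEdges w a b, (∃ s ∈ TriSets H, e ∈ s) →
      (∃ s ∈ TriSets H, e' ∈ s) → e = e' := by
  have key : ∀ e ∈ triEdges w a b, (∃ s ∈ TriSets H, e ∈ s) → e = s(a, b) := by
    rintro e he ⟨s, hs, hes⟩
    have := hw e (TriSets.subset hs hes)
    rcases mem_triEdges.1 he with rfl | rfl | rfl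
    · simp at this
    · rfl
    · simp at this
  intro e he e' he' h h'
  rw [key e he h, key e' he' h']

/-- Edge sets obtained from a triangle by repeatedly attaching a new vertex to an edge. -/
inductive TwoTree : Finset (Sym2 V) → Prop
  | triangle (x y z : V) (hxy : x ≠ y) (hyz : y ≠ z) (hxz : x ≠ z) : TwoTree (triEdges x y z)
  | attach (H : Finset (Sym2 V)) (a b w : V) (hH : TwoTree H) (hab : s(a, b) ∈ H)
      (hw : ∀ e ∈ H, w ∉ e) : TwoTree (insert s(w, a) (insert s(w, b) H))

lemma TwoTree.not_isDiag (h : TwoTree H) : ∀ e ∈ H, ¬ e.IsDiag := by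
  induction h with
  | triangle x y z hxy hyz hxz =>
    intro e he
    rcases mem_triEdges.1 he with rfl | rfl | rfl <;> simpa
  | attach H a b w hH hab hw ih =>
    intro e he
    have := hw _ hab
    simp only [Sym2.mem_iff, not_or] at this
    rw [Finset.mem_insert, Finset.mem_insert] at he
    rcases he with rfl | rfl | he
    · simpa using this.1
    · simpa using this.2
    · exact ih e he

lemma TwoTree.forall_paired (h : TwoTree H) : ∀ f, Paired (TriSets H) f := by
  induction h with
  | triangle x y z hxy hyz hxz =>
    have h0 : ∀ f : Sym2 V, Paired ∅ f := fun f => ⟨id, fun _ => rfl, rfl, by simp⟩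
    intro f
    refine (forall_paired_insert_leaf h0 (card_triEdges hxy hyz hxz) (by simp) f).mono ?_
    intro t ht
    refine .inl (Finset.eq_of_subset_of_card_le (TriSets.subset ht) ?_)
    rw [TriSets.card ht, card_triEdges hxy hyz hxz]
  | attach H a b w hH hab hw ih =>
    have hw' := hw _ hab
    have hd := hH.not_isDiag _ hab
    simp only [Sym2.mem_iff, not_or] at hw'
    intro f
    exact (forall_paired_insert_leaf ih (card_triEdges hw'.1 (by simpa using hd) hw'.2)
      (attach_leaf hw) f).mono (triSets_attach_subset hw)

/-- The response to a first move at the edge `s(x, y)` that joins a vertex `x` of degree two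
in a two-tree to a further neighbour of one of its neighbours. -/
lemma TwoTree.exists_response_of_leaf (h : TwoTree H) {x y z b : V} (hzb : s(z, b) ∈ H)
    (hyz : s(y, z) ∈ H) (hx : ∀ e ∈ H, x ∉ e) (hyb : y ≠ b) :
    ∃ g ≠ s(x, y), Paired {t ∈ TriSets (insert s(x, y) (insert s(x, z) (insert s(x, b) H))) |
      g ∉ t} s(x, y) := by
  have hx1 := hx _ hzb
  have hx2 := hx _ hyz
  have hd1 := h.not_isDiag _ hzb
  have hd2 := h.not_isDiag _ hyz
  simp only [Sym2.mem_iff, not_or, Sym2.mk_isDiag_iff] at hx1 hx2 hd1 hd2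
  have hmem : ∀ c, s(x, c) ∈ insert s(x, y) (insert s(x, z) (insert s(x, b) H)) →
      c = y ∨ c = z ∨ c = b := by
    intro c hc
    simp only [Finset.mem_insert, Sym2.congr_right] at hc
    rcases hc with h | h | h | h
    · exact .inl h
    · exact .inr (.inl h)
    · exact .inr (.inr h)
    · exact absurd (Sym2.mem_mk_left _ _) (hx _ h)
  have htri : ∀ t ∈ TriSets (insert s(x, y) (insert s(x, z) (insert s(x, b) H))),
      t ∈ TriSets H ∨ t = triEdges x z b ∨ t = triEdges x z y ∨
        (t = triEdges x y b ∧ s(y, b) ∈ H) := by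
    intro t ht
    by_cases hsub : t ⊆ H
    · exact .inl (TriSets.of_subset ht hsub)
    right
    obtain ⟨e, he, heH⟩ := Finset.not_subset.1 hsub
    have hwe : x ∈ e := by
      have := TriSets.subset ht he
      simp only [Finset.mem_insert] at this
      rcases this with rfl | rfl | rfl | h
      · simp
      · simp
      · simp
      · exact absurd h heH
    obtain ⟨u, v, ⟨h1, h2, h3, h4, h5, h6⟩, rfl⟩ := TriSets.exists_of_mem_vertex ht he hwe
    have hsw : ∀ p q : V, triEdges x p q = triEdges x q p := by
      intro p q
      rw [triEdges_rotate, triEdges_rotate, triEdges_swap]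
    have h5' : s(u, v) ∈ H := by
      simp only [Finset.mem_insert, Sym2.eq_iff] at h5
      grind
    rcases hmem u h4 with rfl | rfl | rfl <;> rcases hmem v h6 with rfl | rfl | rfl <;>
      simp_all [Sym2.eq_swap]
  by_cases hyb' : s(y, b) ∈ H
  · refine ⟨s(z, b), ?_, ?_⟩
    · simp only [ne_eq, Sym2.eq_iff]
      grind
    have n1 : s(x, b) ≠ s(x, z) := by rw [Ne, Sym2.eq_iff]; grind
    have n2 : s(x, b) ≠ s(y, z) := by rw [Ne, Sym2.eq_iff]; grind
    have n3 : s(y, b) ≠ s(x, z) := by rw [Ne, Sym2.eq_iff]; grind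
    have n4 : s(y, b) ≠ s(y, z) := by rw [Ne, Sym2.eq_iff]; grind
    have n5 : s(x, y) ≠ s(x, b) := by rw [Ne, Sym2.eq_iff]; grind
    have n6 : s(x, y) ≠ s(y, b) := by rw [Ne, Sym2.eq_iff]; grind
    have n7 : s(x, y) ≠ s(x, z) := by rw [Ne, Sym2.eq_iff]; grind
    have n8 : s(x, y) ≠ s(y, z) := by rw [Ne, Sym2.eq_iff]; grind
    have n9 : s(y, z) ≠ s(x, z) := by rw [Ne, Sym2.eq_iff]; grind
    have n10 : s(y, b) ≠ s(x, b) := by rw [Ne, Sym2.eq_iff]; grind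
    obtain ⟨σ, hσ, hσf, hout, hin⟩ := (h.forall_paired s(z, b)).exists_fixing_outside
    have hyzb : triEdges y z b ∈ TriSets H := ⟨y, z, b, ⟨hd2, hd1, hyb, hyz, hzb, hyb'⟩, rfl⟩
    have hσy : σ s(y, z) = s(y, b) := by
      obtain ⟨e, he, he', hne⟩ := hin _ hyzb
      have hinv := hσ e
      simp only [mem_triEdges] at he he'
      grind
    obtain ⟨τ, hτ, hτ1, hτ2, hτ3⟩ := exists_involutive_remove hσ s(y, z)
    rw [hσy] at hτ2 hτ3
    have hfree : ∀ e, x ∈ e → τ e = e := by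
      intro e hxe
      rw [hτ3 e (by rintro rfl; simp at hxe; tauto) (by rintro rfl; simp at hxe; tauto)]
      exact hout e fun t ht het => hx e (TriSets.subset ht het) hxe
    obtain ⟨υ, hυ, hυ1, hυ2, hυ3⟩ :=
      exists_involutive_extend hτ (hfree s(x, z) (by simp)) hτ1
    obtain ⟨ρ, hρ, hρ1, hρ2, hρ3⟩ : ∃ ρ : Sym2 V → Sym2 V, ρ.Involutive ∧
        ρ s(x, b) = s(y, b) ∧ ρ s(y, b) = s(x, b) ∧
          ∀ e, e ≠ s(x, b) → e ≠ s(y, b) → ρ e = υ e := by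
      apply exists_involutive_extend hυ
      · rw [hυ3 _ n1 n2]
        exact hfree _ (by simp)
      · rw [hυ3 _ n3 n4]
        exact hτ2
    refine ⟨ρ, hρ, ?_, ?_⟩
    · rw [hρ3 _ n5 n6, hυ3 _ n7 n8]
      exact hfree _ (by simp)
    · rintro t ⟨ht, hzbt⟩
      rcases htri t ht with h1 | rfl | rfl | ⟨rfl, -⟩
      · obtain ⟨e, he, he', hne⟩ := hin t h1
        have hxe : x ∉ e := hx e (TriSets.subset h1 he)
        have hboth : ¬ (s(y, z) ∈ t ∧ s(y, b) ∈ t) := by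
          rintro ⟨h2, h3⟩
          refine hzbt ?_
          rw [(TriSets.exists_apex_of_mem h1 h2 h3 hd1).1]
          simp [triEdges]
        have hinv := hσ s(y, z)
        have h4 : e ≠ s(y, z) := by rintro rfl; exact hboth ⟨he, hσy ▸ he'⟩
        have h5 : e ≠ s(y, b) := by
          rintro rfl
          rw [hσy] at hinv
          exact hboth ⟨hinv ▸ he', he⟩
        have h6 : ρ e = σ e := by
          rw [hρ3 e (by rintro rfl; simp at hxe) h5, hυ3 e (by rintro rfl; simp at hxe) h4,
            hτ3 e h4 h5]
        exact ⟨e, he, h6 ▸ he', h6 ▸ hne⟩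
      · simp [triEdges] at hzbt
      · have h7 : ρ s(x, z) = s(y, z) := by
          rw [hρ3 _ n1.symm n3.symm, hυ1]
        refine ⟨s(x, z), by simp [triEdges], ?_, ?_⟩
        · rw [h7]; simp [triEdges, Sym2.eq_swap]
        · rw [h7]; exact n9
      · refine ⟨s(x, b), by simp [triEdges], ?_, ?_⟩
        · rw [hρ1]; simp [triEdges]
        · rw [hρ1]; exact n10
  · refine ⟨s(x, z), ?_, ?_⟩
    · rw [Ne, Sym2.eq_iff]; grind
    · refine (h.forall_paired _).mono ?_
      rintro t ⟨ht, hxz⟩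
      rcases htri t ht with h1 | rfl | rfl | h1
      · exact h1
      · simp [triEdges] at hxz
      · simp [triEdges] at hxz
      · exact absurd h1.2 hyb'

end Triangles

section Growth

variable {C D H : Finset (Sym2 V)}

lemma TwoTree.exists_response (h : TwoTree H) : ∀ x y z : V, x ≠ y → s(x, y) ∉ H →
    s(x, z) ∈ H → s(y, z) ∈ H →
    ∃ g ≠ s(x, y), Paired {t ∈ TriSets (insert s(x, y) H) | g ∉ t} s(x, y) := by
  induction h with
  | triangle u v w huv hvw huw =>
    intro x y z hxy h1 h2 h3
    simp only [mem_triEdges, Sym2.eq_iff] at h1 h2 h3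
    grind
  | attach H a b w hH hab hw ih =>
    have hwab := hw _ hab
    simp only [Sym2.mem_iff, not_or] at hwab
    have hmem : ∀ c, s(w, c) ∈ insert s(w, a) (insert s(w, b) H) → c = a ∨ c = b := by
      intro c hc
      rw [Finset.mem_insert, Finset.mem_insert] at hc
      rcases hc with h | h | h
      · exact .inl (Sym2.congr_right.1 h)
      · exact .inr (Sym2.congr_right.1 h)
      · exact absurd (Sym2.mem_mk_left _ _) (hw _ h)
    have hold : ∀ c d, c ≠ w → d ≠ w → s(c, d) ∈ insert s(w, a) (insert s(w, b) H) →
        s(c, d) ∈ H := by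
      intro c d hc hd h
      rw [Finset.mem_insert, Finset.mem_insert, Sym2.eq_iff, Sym2.eq_iff] at h
      grind
    have leaf : ∀ y z, w ≠ y → s(w, y) ∉ insert s(w, a) (insert s(w, b) H) →
        s(w, z) ∈ insert s(w, a) (insert s(w, b) H) →
        s(y, z) ∈ insert s(w, a) (insert s(w, b) H) →
        ∃ g ≠ s(w, y), Paired {t ∈ TriSets (insert s(w, y)
          (insert s(w, a) (insert s(w, b) H))) | g ∉ t} s(w, y) := by
      intro y z hwy h1 h2 h3
      have hya : y ≠ a := by rintro rfl; simp at h1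
      have hyb : y ≠ b := by rintro rfl; simp at h1
      rcases hmem z h2 with rfl | rfl
      · exact hH.exists_response_of_leaf hab (hold _ _ hwy.symm (Ne.symm hwab.1) h3) hw hyb
      · rw [Finset.insert_comm s(w, a)]
        exact hH.exists_response_of_leaf (Sym2.eq_swap ▸ hab)
          (hold _ _ hwy.symm (Ne.symm hwab.2) h3) hw hya
    intro x y z hxy h1 h2 h3
    by_cases hxw : x = w
    · subst hxw
      exact leaf y z hxy h1 h2 h3
    by_cases hyw : y = w
    · subst hyw
      rw [Sym2.eq_swap (a := x)] at h1 ⊢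
      exact leaf x z hxy.symm h1 h3 h2
    by_cases hzw : z = w
    · subst hzw
      have hxz : s(x, z) = s(z, x) := Sym2.eq_swap
      have hyz : s(y, z) = s(z, y) := Sym2.eq_swap
      exfalso
      rcases hmem x (hxz ▸ h2) with rfl | rfl <;> rcases hmem y (hyz ▸ h3) with rfl | rfl
      · exact hxy rfl
      · exact h1 (Finset.mem_insert_of_mem (Finset.mem_insert_of_mem hab))
      · exact h1 (Finset.mem_insert_of_mem (Finset.mem_insert_of_mem (Sym2.eq_swap ▸ hab)))
      · exact hxy rfl
    have h1' : s(x, y) ∉ H := fun h => h1 (by simp [h])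
    obtain ⟨g, hg, hP⟩ := ih x y z hxy h1' (hold _ _ hxw hzw h2) (hold _ _ hyw hzw h3)
    have hw' : ∀ e ∈ insert s(x, y) H, w ∉ e := by
      intro e he
      rcases Finset.mem_insert.1 he with rfl | he
      · simp only [Sym2.mem_iff, not_or]
        exact ⟨Ne.symm hxw, Ne.symm hyw⟩
      · exact hw e he
    obtain ⟨k, hk, hins⟩ := Paired.insert_leaf (card_triEdges hwab.1
      (by simpa using hH.not_isDiag _ hab) hwab.2) (attach_leaf hw') s(x, y)
    have hk' : k = s(x, y) := by
      refine hk.resolve_right fun h => ?_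
      rcases mem_triEdges.1 h.1 with h4 | h4 | h4
      · exact hxw (by rw [Sym2.eq_iff] at h4; grind)
      · exact h1' (h4 ▸ hab)
      · exact hxw (by rw [Sym2.eq_iff] at h4; grind)
    subst hk'
    refine ⟨g, hg, (hins _ (fun s hs => hs.1) hP).mono ?_⟩
    rintro t ⟨ht, hgt⟩
    have hcomm : insert s(x, y) (insert s(w, a) (insert s(w, b) H)) =
        insert s(w, a) (insert s(w, b) (insert s(x, y) H)) := by
      rw [Finset.insert_comm s(x, y), Finset.insert_comm s(x, y)]
    rw [hcomm] at ht
    rcases triSets_attach_subset hw' ht with h | h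
    · exact .inl h
    · exact .inr ⟨h, hgt⟩

lemma TwoTree.answerable_insert (h : TwoTree H) {x y z : V} (hxy : x ≠ y) (h1 : s(x, y) ∉ H)
    (h2 : s(x, z) ∈ H) (h3 : s(y, z) ∈ H) : Answerable (TriSets (insert s(x, y) H)) := by
  intro f
  by_cases hf : f = s(x, y)
  · subst hf
    exact h.exists_response x y z hxy h1 h2 h3
  · refine ⟨s(x, y), Ne.symm hf, (h.forall_paired f).mono ?_⟩
    rintro t ⟨ht, hxyt⟩
    refine TriSets.of_subset ht fun e he => ?_
    refine (Finset.mem_insert.1 (TriSets.subset ht he)).resolve_left ?_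
    rintro rfl
    exact hxyt he

lemma IsTriangleCollection.exists_adjacent (hC : IsTriangleCollection C) (hD : D ⊂ C)
    {t₀ : Finset (Sym2 V)} (ht₀ : t₀ ∈ TriSets D) :
    ∃ t ∈ TriSets C, (t ∩ D).Nonempty ∧ ¬ t ⊆ D := by
  by_contra! hcon
  obtain ⟨e, heC, heD⟩ := Finset.exists_of_ssubset hD
  obtain ⟨x, y, z, hxyz, he⟩ := hC.1 e heC
  have hreach := hC.2 t₀ (TriSets.of_subset ht₀ ((TriSets.subset ht₀).trans hD.subset))
    _ ⟨x, y, z, hxyz, rfl⟩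
  have key : ∀ t, Relation.ReflTransGen
      (fun a b => a ∈ TriSets C ∧ b ∈ TriSets C ∧ (a ∩ b).Nonempty) t₀ t → t ⊆ D := by
    intro t ht
    induction ht with
    | refl => exact TriSets.subset ht₀
    | tail _ hst ih =>
      obtain ⟨-, hb, e', he'⟩ := hst
      rw [Finset.mem_inter] at he'
      exact hcon _ hb ⟨e', Finset.mem_inter.2 ⟨he'.2, ih he'.1⟩⟩
  exact heD (key _ hreach he)

variable [Fintype V]

lemma mem_support {v : V} : v ∈ support D ↔ ∃ e ∈ D, v ∈ e := by
  simp [support]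

/-- The possible shapes, counted by excess of edges over vertices, of a set of edges grown from a
triangle by adding adjacent triangles. -/
def GrowthState (D : Finset (Sym2 V)) : Prop :=
  (TwoTree D ∧ 2 * (support D).card ≤ D.card + 3) ∨
  (Answerable (TriSets D) ∧ 2 * (support D).card ≤ D.card + 2) ∨
  2 * (support D).card ≤ D.card + 1

lemma GrowthState.triangle {x y z : V} (hxy : x ≠ y) (hyz : y ≠ z) (hxz : x ≠ z) :
    GrowthState (triEdges x y z) := by
  refine .inl ⟨.triangle x y z hxy hyz hxz, ?_⟩
  have : support (triEdges x y z) ⊆ {x, y, z} := by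
    intro v hv
    obtain ⟨e, he, hv⟩ := mem_support.1 hv
    rcases mem_triEdges.1 he with rfl | rfl | rfl <;> simp at hv ⊢ <;> tauto
  have := (Finset.card_le_card this).trans Finset.card_le_three
  rw [card_triEdges hxy hyz hxz]
  omega

lemma GrowthState.attach (h : GrowthState D) {a b w : V} (hab : s(a, b) ∈ D) (hne : a ≠ b)
    (hwa : w ≠ a) (hwb : w ≠ b) (hnew : s(w, a) ∉ D ∨ s(w, b) ∉ D) :
    GrowthState (insert s(w, a) (insert s(w, b) D)) := by
  have hsupp : support (insert s(w, a) (insert s(w, b) D)) ⊆ insert w (support D) := by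
    intro v hv
    obtain ⟨e, he, hv⟩ := mem_support.1 hv
    have ha : a ∈ support D := mem_support.2 ⟨_, hab, by simp⟩
    have hb : b ∈ support D := mem_support.2 ⟨_, hab, by simp⟩
    rw [Finset.mem_insert, Finset.mem_insert] at he
    rw [Finset.mem_insert]
    rcases he with rfl | rfl | he
    · rcases Sym2.mem_iff.1 hv with rfl | rfl
      exacts [.inl rfl, .inr ha]
    · rcases Sym2.mem_iff.1 hv with rfl | rfl
      exacts [.inl rfl, .inr hb]
    · exact .inr (mem_support.2 ⟨e, he, hv⟩)
  have hsupp' := Finset.card_le_card hsupp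
  have hd : s(w, a) ≠ s(w, b) := by rwa [Ne, Sym2.congr_right]
  by_cases hw : ∀ e ∈ D, w ∉ e
  · have h1 : s(w, a) ∉ D := fun h => hw _ h (by simp)
    have h2 : s(w, b) ∉ D := fun h => hw _ h (by simp)
    have hcard : (insert s(w, a) (insert s(w, b) D)).card = D.card + 2 := by
      rw [Finset.card_insert_of_notMem (by simp [h1, hne, hwb]),
        Finset.card_insert_of_notMem h2]
    have := Finset.card_insert_le w (support D)
    rcases h with ⟨h, hc⟩ | ⟨h, hc⟩ | hc
    · exact .inl ⟨TwoTree.attach _ _ _ _ h hab hw, by omega⟩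
    · exact .inr (.inl ⟨(h.insert_leaf (card_triEdges hwa hne hwb) (attach_leaf hw)).mono
        (triSets_attach_subset hw), by omega⟩)
    · exact .inr (.inr (by omega))
  · push Not at hw
    rw [Finset.insert_eq_of_mem (mem_support.2 hw)] at hsupp'
    by_cases h2 : s(w, b) ∈ D
    · have h1 := hnew.resolve_right (not_not_intro h2)
      rw [Finset.insert_eq_of_mem h2] at hsupp' ⊢
      have hcard := Finset.card_insert_of_notMem h1
      rcases h with ⟨h, hc⟩ | ⟨h, hc⟩ | hc
      · exact .inr (.inl ⟨h.answerable_insert hwa h1 h2 hab, by omega⟩)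
      all_goals exact .inr (.inr (by omega))
    · have hcard := Finset.card_insert_of_notMem h2
      by_cases h1 : s(w, a) ∈ D
      · rw [Finset.insert_eq_of_mem (Finset.mem_insert_of_mem h1)] at hsupp' ⊢
        rcases h with ⟨h, hc⟩ | ⟨h, hc⟩ | hc
        · exact .inr (.inl ⟨h.answerable_insert hwb h2 h1 (Sym2.eq_swap ▸ hab), by omega⟩)
        all_goals exact .inr (.inr (by omega))
      · have hcard' : (insert s(w, a) (insert s(w, b) D)).card = (insert s(w, b) D).card + 1 :=
          Finset.card_insert_of_notMem (by rw [Finset.mem_insert]; tauto)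
        refine .inr (.inr ?_)
        rcases h with ⟨h, hc⟩ | ⟨h, hc⟩ | hc <;> omega

lemma IsTriangleCollection.growthState_of_subset (hC : IsTriangleCollection C) (n : ℕ) :
    ∀ D ⊆ C, (C \ D).card = n → ∀ t₀ ∈ TriSets D, GrowthState D → GrowthState C := by
  induction n using Nat.strong_induction_on with
  | h n ih =>
  intro D hDC hn t₀ ht₀ hD
  rcases hDC.eq_or_ssubset with rfl | hss
  · exact hD
  obtain ⟨t, ht, ⟨e, he⟩, hsub⟩ := hC.exists_adjacent hss ht₀
  rw [Finset.mem_inter] at he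
  induction e with | h a b =>
  obtain ⟨w, hw, rfl⟩ := TriSets.exists_apex ht he.1
  have hbw : s(b, w) = s(w, b) := Sym2.eq_swap
  have haw : s(a, w) = s(w, a) := Sym2.eq_swap
  obtain ⟨hab, hbw', haw', -, h5, h6⟩ := hw
  rw [hbw] at h5
  rw [haw] at h6
  have hnew : s(w, a) ∉ D ∨ s(w, b) ∉ D := by
    by_contra! hcon
    refine hsub fun e' he' => ?_
    rcases mem_triEdges.1 he' with rfl | rfl | rfl
    exacts [he.2, hbw ▸ hcon.2, haw ▸ hcon.1]
  have hD'C : insert s(w, a) (insert s(w, b) D) ⊆ C :=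
    Finset.insert_subset h6 (Finset.insert_subset h5 hDC)
  have hDD' : D ⊂ insert s(w, a) (insert s(w, b) D) := by
    refine ⟨fun e he => by simp [he], fun h => ?_⟩
    rcases hnew with h1 | h1
    · exact h1 (h (by simp))
    · exact h1 (h (by simp))
  refine ih _ ?_ _ hD'C rfl t₀ (TriSets.of_subset ht₀ ((TriSets.subset ht₀).trans hDD'.subset))
    (hD.attach he.2 hab haw'.symm hbw'.symm hnew)
  rw [← hn]
  have h7 := Finset.card_lt_card hDD'
  have h8 := Finset.card_le_card hD'C
  rw [Finset.card_sdiff_of_subset hD'C, Finset.card_sdiff_of_subset hDC]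
  omega

lemma IsTriangleCollection.le_card_of_oMakerWin (hC : IsTriangleCollection C)
    (hwin : OMakerWin C HasCyclicTriangle 1 ∅ ∅) :
    C.Nonempty ∧ 2 * (support C).card ≤ C.card + 1 := by
  have hne : C.Nonempty := by
    rcases hwin with ⟨_, _, x, y, z, -, -, -, h, -⟩ | ⟨_, _, x, y, h, -⟩
    · simp at h
    · exact ⟨_, h⟩
  refine ⟨hne, ?_⟩
  obtain ⟨e, he⟩ := hne
  obtain ⟨x, y, z, h, -⟩ := hC.1 e he
  have : Nontrivial (Sym2 V) := ⟨s(x, y), s(x, x), by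
    rw [Ne, Sym2.congr_right]; exact h.1.symm⟩
  rcases hC.growthState_of_subset _ _ h.triEdges_subset rfl _
    ⟨x, y, z, ⟨h.1, h.2.1, h.2.2.1, by simp [triEdges], by simp [triEdges],
      by simp [triEdges]⟩, rfl⟩ (.triangle h.1 h.2.1 h.2.2.1) with ⟨h, -⟩ | ⟨h, -⟩ | h
  · exact absurd hwin (Answerable.of_paired h.forall_paired).not_oMakerWin
  · exact absurd hwin h.not_oMakerWin
  · exact h

end Growth

section Basic

variable {A C D : Finset (Sym2 V)} {𝒯 : Set (Finset (Sym2 V))} {t t₀ t₁ t₂ : Finset (Sym2 V)}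

lemma TriSets.exists_path {e e' : Sym2 V} (ht : t ∈ TriSets A) (he : e ∈ t) (he' : e' ∈ t)
    (hne : e ≠ e') : ∃ x y z, IsTriangleIn A x y z ∧ t = triEdges x y z ∧ e = s(x, y) ∧
      e' = s(y, z) := by
  induction e with | h a b =>
  obtain ⟨c, hc, rfl⟩ := TriSets.exists_apex ht he
  rcases mem_triEdges.1 he' with h | h | h
  · exact absurd h.symm hne
  · exact ⟨a, b, c, hc, rfl, rfl, h⟩
  · exact ⟨b, a, c, hc.swap, triEdges_swap a b c, Sym2.eq_swap, h⟩

lemma forall_paired_empty (f : Sym2 V) : Paired ∅ f :=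
  ⟨id, fun _ => rfl, rfl, by simp⟩

lemma forall_paired_insert_of_subsingleton (h : ∀ f, Paired 𝒯 f) (h𝒯 : 𝒯 ⊆ TriSets A)
    (ht : t ∈ TriSets A)
    (hn : ∀ s ∈ 𝒯, ∀ s' ∈ 𝒯, (t ∩ s).Nonempty → (t ∩ s').Nonempty → s = s') :
    ∀ f, Paired (insert t 𝒯) f := by
  by_cases hmem : t ∈ 𝒯
  · rwa [Set.insert_eq_of_mem hmem]
  refine forall_paired_insert_leaf h (TriSets.card ht) ?_
  rintro e he e' he' ⟨s, hs, hes⟩ ⟨s', hs', hes'⟩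
  obtain rfl := hn s hs s' hs' ⟨e, Finset.mem_inter.2 ⟨he, hes⟩⟩
    ⟨e', Finset.mem_inter.2 ⟨he', hes'⟩⟩
  by_contra hne
  exact hmem (TriSets.eq_of_common ht (h𝒯 hs) hne he he' hes hes' ▸ hs)

lemma forall_paired_pair (h₁ : t₁ ∈ TriSets A) (h₂ : t₂ ∈ TriSets A) :
    ∀ f, Paired {t₁, t₂} f := by
  have h : ∀ f, Paired {t₂} f := by
    rw [← insert_empty_eq]
    exact forall_paired_insert_of_subsingleton forall_paired_empty (Set.empty_subset _) h₂ (by simp)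
  exact forall_paired_insert_of_subsingleton h (by simpa) h₁ (by simp +contextual)

/-- Three triangles which are not three of the faces of a `K₄` can be blocked by a pairing. -/
lemma forall_paired_triple (h₀ : t₀ ∈ TriSets A) (h₁ : t₁ ∈ TriSets A) (h₂ : t₂ ∈ TriSets A)
    (hA : t₀ ≠ t₁ → ∀ t ∈ TriSets A, (t₀ ∩ t).Nonempty → (t₁ ∩ t).Nonempty → (t₂ ∩ t).Nonempty →
      t = t₀ ∨ t = t₁ ∨ t = t₂) :
    ∀ f, Paired {t₀, t₁, t₂} f := by
  by_cases h01 : t₀ = t₁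
  · rw [h01, Set.insert_eq_of_mem (by simp)]
    exact forall_paired_pair h₁ h₂
  by_cases h02 : t₀ = t₂
  · rw [h02, Set.insert_eq_of_mem (by simp)]
    exact forall_paired_pair h₁ h₂
  by_cases h12 : (t₁ ∩ t₂).Nonempty
  swap
  · rw [Set.insert_comm]
    refine forall_paired_insert_of_subsingleton (forall_paired_pair h₀ h₂)
      (Set.insert_subset h₀ (by simpa)) h₁ ?_
    rintro s (rfl | rfl) s' (rfl | rfl) hs hs'
    all_goals first | rfl | exact absurd hs h12 | exact absurd hs' h12
  refine forall_paired_insert_leaf (forall_paired_pair h₁ h₂) (TriSets.card h₀) ?_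
  have key : ∀ e ∈ t₀, ∀ e' ∈ t₀, e ∈ t₁ → e' ∈ t₂ → e = e' := by
    intro e he e' he' h1 h2
    by_contra hne
    obtain ⟨x, y, z, h, rfl, rfl, rfl⟩ := TriSets.exists_path h₀ he he' hne
    obtain ⟨w, hw, rfl⟩ := TriSets.exists_apex h₁ h1
    obtain ⟨u, hu, rfl⟩ := TriSets.exists_apex h₂ h2
    have hwz : w ≠ z := by rintro rfl; exact h01 rfl
    have hux : u ≠ x := by rintro rfl; exact h02 (triEdges_rotate _ _ _)
    obtain ⟨p1, p2, p3, -, -, p4⟩ := h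
    obtain ⟨-, q2, q3, -, q5, q6⟩ := hw
    obtain ⟨-, r2, r3, -, r5, r6⟩ := hu
    obtain rfl : w = u := by
      obtain ⟨e, he⟩ := h12
      simp only [Finset.mem_inter, mem_triEdges] at he
      induction e with | h a b =>
      simp only [Sym2.eq_iff] at he
      grind
    have h3 := hA h01 (triEdges x z w) ⟨x, z, w, ⟨p3, r2, q3, p4, r5, q6⟩, rfl⟩
      ⟨s(x, z), by simp [triEdges]⟩ ⟨s(x, w), by simp [triEdges]⟩ ⟨s(z, w), by simp [triEdges]⟩
    have hxz : s(x, z) ∈ triEdges x z w := by simp [triEdges]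
    have hzw : s(z, w) ∈ triEdges x z w := by simp [triEdges]
    rcases h3 with h3 | h3 | h3
    · rw [h3, mem_triEdges] at hzw
      simp only [Sym2.eq_iff] at hzw
      grind
    · rw [h3, mem_triEdges] at hxz
      simp only [Sym2.eq_iff] at hxz
      grind
    · rw [h3, mem_triEdges] at hxz
      simp only [Sym2.eq_iff] at hxz
      grind
  rintro e he e' he' ⟨s, rfl | rfl, hes⟩ ⟨s', rfl | rfl, hes'⟩
  · by_contra hne
    exact h01 (TriSets.eq_of_common h₀ h₁ hne he he' hes hes')
  · exact key e he e' he' hes hes'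
  · exact (key e' he' e he hes' hes).symm
  · by_contra hne
    exact h02 (TriSets.eq_of_common h₀ h₂ hne he he' hes hes')

/-- If triangles are numbered injectively and the one numbered `n` can only meet a smaller one when
it is numbered `n - 1`, then it can be added to a pairing. -/
lemma forall_paired_lt_succ {ψ : TriSets A → ℕ} (hψ : Function.Injective ψ) {n : ℕ}
    (h : ∀ f, Paired {t | ∃ ht : t ∈ TriSets A, ψ ⟨t, ht⟩ < n} f)
    (hadj : ∀ t s : TriSets A, ψ t = n → ψ s < n → (t.1 ∩ s.1).Nonempty → ψ s + 1 = n) :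
    ∀ f, Paired {t | ∃ ht : t ∈ TriSets A, ψ ⟨t, ht⟩ < n + 1} f := by
  by_cases hn : ∃ t, ψ t = n
  · obtain ⟨t, hn⟩ := hn
    refine fun f => (forall_paired_insert_of_subsingleton h (fun s hs => hs.1) t.2 ?_ f).mono ?_
    · rintro s ⟨hs, hlt⟩ s' ⟨hs', hlt'⟩ hne hne'
      have h1 := hadj t _ hn hlt hne
      have h2 := hadj t _ hn hlt' hne'
      exact congrArg Subtype.val (@hψ ⟨s, hs⟩ ⟨s', hs'⟩ (by omega))
    · rintro s ⟨hs, hlt⟩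
      by_cases hlt' : ψ ⟨s, hs⟩ < n
      · exact .inr ⟨hs, hlt'⟩
      · exact .inl (congrArg Subtype.val (@hψ ⟨s, hs⟩ t (by omega)))
  · refine fun f => (h f).mono ?_
    rintro s ⟨hs, hlt⟩
    have : ψ ⟨s, hs⟩ ≠ n := fun h => hn ⟨_, h⟩
    exact ⟨hs, by omega⟩

lemma VeryBasic.forall_paired (h : VeryBasic A) : ∀ f, Paired (TriSets A) f := by
  rcases h with ⟨φ, hφ, hadj⟩ | ⟨m, φ, hφ, hadj⟩
  · have h3 : ∀ f, Paired {t | ∃ ht : t ∈ TriSets A, (φ ⟨t, ht⟩).val < 3} f := by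
      rcases Set.eq_empty_or_nonempty {t | ∃ ht : t ∈ TriSets A, (φ ⟨t, ht⟩).val < 3} with
        he | ⟨s, hs, hs3⟩
      · rw [he]
        exact forall_paired_empty
      have hT : ∀ i : Fin 4, ∃ t : TriSets A, (φ t).val < 3 ∧
          ∀ t' : TriSets A, (φ t').val < 3 → φ t' = i → t' = t := by
        intro i
        by_cases hi : ∃ t : TriSets A, (φ t).val < 3 ∧ φ t = i
        · obtain ⟨t, ht, rfl⟩ := hi
          exact ⟨t, ht, fun t' _ h => hφ h⟩
        · exact ⟨⟨s, hs⟩, hs3, fun t' h h' => absurd ⟨t', h, h'⟩ hi⟩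
      choose T hT3 hT using hT
      have hsub : {t | ∃ ht : t ∈ TriSets A, (φ ⟨t, ht⟩).val < 3} ⊆
          {(T 0).1, (T 1).1, (T 2).1} := by
        rintro t ⟨ht, h3⟩
        have : φ ⟨t, ht⟩ = 0 ∨ φ ⟨t, ht⟩ = 1 ∨ φ ⟨t, ht⟩ = 2 := by omega
        rcases this with h | h | h
        · exact .inl (congrArg Subtype.val (hT _ _ h3 h))
        · exact .inr (.inl (congrArg Subtype.val (hT _ _ h3 h)))
        · exact .inr (.inr (congrArg Subtype.val (hT _ _ h3 h)))
      refine fun f => (forall_paired_triple (T 0).2 (T 1).2 (T 2).2 ?_ f).mono hsub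
      intro h01 t ht hn0 hn1 hn2
      by_cases h : (φ ⟨t, ht⟩).val < 3
      · exact hsub ⟨ht, h⟩
      have hφT : ∀ i, (t ∩ (T i).1).Nonempty → (φ (T i)).val = 2 := by
        intro i hi
        have := hT3 i
        have hne : (⟨t, ht⟩ : TriSets A) ≠ T i := fun h' => h (h' ▸ this)
        rcases hadj _ _ hne hi with h | h | h <;> omega
      rw [Finset.inter_comm] at hn0 hn1
      have h0 := hφT _ hn0
      have h1 := hφT _ hn1
      exact absurd (congrArg Subtype.val (hφ (Fin.ext (h0.trans h1.symm)))) h01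
    refine fun f => (forall_paired_lt_succ (Fin.val_injective.comp hφ) h3 ?_ f).mono
      fun t ht => ⟨ht, Fin.is_lt _⟩
    intro t s ht hs hne
    simp only [Function.comp_apply] at *
    have hts : t ≠ s := by
      rintro rfl
      omega
    rcases hadj _ _ hts hne with h | h | h <;> omega
  · have key : ∀ n : ℕ, ∀ f, Paired {t | ∃ ht : t ∈ TriSets A, (φ ⟨t, ht⟩).val < n} f := by
      intro n
      induction n with
      | zero => simpa using forall_paired_empty
      | succ n ih =>
        refine forall_paired_lt_succ (Fin.val_injective.comp hφ) ih ?_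
        intro t s ht hs hne
        simp only [Function.comp_apply] at *
        have hts : t ≠ s := by
          rintro rfl
          omega
        rcases hadj _ _ hts hne with h | h <;> omega
    exact fun f => (key m f).mono fun t ht => ⟨ht, Fin.is_lt _⟩

lemma Basic.answerable (h : Basic C) : Answerable (TriSets C) := by
  obtain ⟨e₁, -, e₂, -, hne, h1, h2⟩ := h
  have key : ∀ g, {t ∈ TriSets C | g ∉ t} ⊆ TriSets (C.erase g) := fun g t ht =>
    TriSets.of_subset ht.1 (Finset.subset_erase.2 ⟨TriSets.subset ht.1, ht.2⟩)
  intro f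
  by_cases hf : e₁ = f
  · exact ⟨e₂, fun h => hne (hf.trans h.symm), (h2.forall_paired f).mono (key _)⟩
  · exact ⟨e₁, hf, (h1.forall_paired f).mono (key _)⟩

end Basic

section MinDegree

variable {C D : Finset (Sym2 V)} {v x y : V}

lemma IsTriangleCollection.of_remove_vertex (hC : IsTriangleCollection C)
    (hT : IsTriangleIn C v x y) (hv : ∀ e ∈ C, v ∈ e → e = s(v, x) ∨ e = s(v, y))
    (hD : ∀ e, e ∈ D ↔ e ∈ C ∧ v ∉ e) (hcard : 3 < C.card) : IsTriangleCollection D := by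
  have hT' : triEdges v x y ∈ TriSets C := ⟨v, x, y, hT, rfl⟩
  have hapex : ∀ t ∈ TriSets C, ∀ e ∈ t, v ∈ e → t = triEdges v x y := by
    intro t ht e he hve
    obtain ⟨a, b, ⟨-, h2, -, h4, -, h6⟩, rfl⟩ := TriSets.exists_of_mem_vertex ht he hve
    have ha := hv _ h4 (by simp)
    have hb := hv _ h6 (by simp)
    rw [Sym2.congr_right, Sym2.congr_right] at ha hb
    rcases ha with rfl | rfl <;> rcases hb with rfl | rfl
    · exact absurd rfl h2
    · rfl
    · rw [triEdges_rotate, triEdges_swap, ← triEdges_rotate]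
    · exact absurd rfl h2
  have hCD : ∀ t ∈ TriSets C, t ≠ triEdges v x y → t ∈ TriSets D := fun t ht hne =>
    TriSets.of_subset ht fun e he =>
      (hD e).2 ⟨TriSets.subset ht he, fun h => hne (hapex t ht e he h)⟩
  have hDC : ∀ t ∈ TriSets D, t ∈ TriSets C := fun t ht =>
    TriSets.of_subset ht fun e he => ((hD e).1 (TriSets.subset ht he)).1
  have hxy : ∀ e ∈ triEdges v x y, v ∉ e → e = s(x, y) := by
    intro e he hve
    rcases mem_triEdges.1 he with rfl | rfl | rfl
    · simp at hve
    · rfl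
    · simp at hve
  have hDT : ∀ t ∈ TriSets D, ∀ e ∈ t, e ∈ triEdges v x y → e = s(x, y) := fun t ht e he he' =>
    hxy e he' ((hD e).1 (TriSets.subset ht he)).2
  have hss : triEdges v x y ⊂ C := by
    refine (Finset.ssubset_iff_subset_ne).2 ⟨hT.triEdges_subset, fun h => ?_⟩
    rw [← h, card_triEdges hT.1 hT.2.1 hT.2.2.1] at hcard
    omega
  obtain ⟨t₁, ht₁, ⟨e₁, he₁⟩, hnsub⟩ := hC.exists_adjacent hss
    (TriSets.of_subset hT' subset_rfl)
  have ht₁D := hCD t₁ ht₁ fun h => hnsub h.subset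
  rw [Finset.mem_inter] at he₁
  obtain rfl := hDT t₁ ht₁D e₁ he₁.1 he₁.2
  refine ⟨fun e he => ?_, fun t ht t' ht' => ?_⟩
  · obtain ⟨heC, hve⟩ := (hD e).1 he
    obtain ⟨a, b, c, habc, heabc⟩ := hC.1 e heC
    have : ∃ t ∈ TriSets D, e ∈ t := by
      by_cases h : triEdges a b c = triEdges v x y
      · exact ⟨t₁, ht₁D, (hxy e (h ▸ heabc) hve) ▸ he₁.1⟩
      · exact ⟨_, hCD _ ⟨a, b, c, habc, rfl⟩ h, heabc⟩
    obtain ⟨t, ⟨a, b, c, h, rfl⟩, het⟩ := this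
    exact ⟨a, b, c, h, het⟩
  · have key : ∀ s, Relation.ReflTransGen
        (fun a b => a ∈ TriSets C ∧ b ∈ TriSets C ∧ (a ∩ b).Nonempty) t s →
        ∀ u ∈ TriSets D, (u = s ∨ s = triEdges v x y ∧ s(x, y) ∈ u) →
          Relation.ReflTransGen
            (fun a b => a ∈ TriSets D ∧ b ∈ TriSets D ∧ (a ∩ b).Nonempty) t u := by
      intro s hs
      induction hs with
      | refl =>
        rintro u hu (rfl | ⟨rfl, -⟩)
        · exact .refl
        · exact absurd ((hD _).1 (TriSets.subset ht (by simp [triEdges] : s(v, x) ∈ _))).2 (by simp)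
      | @tail b c hb hbc ih =>
        obtain ⟨hbC, hcC, e, he⟩ := hbc
        rw [Finset.mem_inter] at he
        intro u hu hor
        by_cases hbT : b = triEdges v x y
        · refine ih u hu (.inr ⟨hbT, ?_⟩)
          rcases hor with rfl | ⟨-, h⟩
          · exact hDT u hu e he.2 (hbT ▸ he.1) ▸ he.2
          · exact h
        · have hbD := hCD b hbC hbT
          refine (ih b hbD (.inl rfl)).tail ⟨hbD, hu, ?_⟩
          rcases hor with rfl | ⟨rfl, h⟩
          · exact ⟨e, Finset.mem_inter.2 he⟩
          · exact ⟨_, Finset.mem_inter.2 ⟨hDT b hbD e he.1 he.2 ▸ he.1, h⟩⟩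
    exact key t' (hC.2 t (hDC t ht) t' (hDC t' ht')) t' ht' (.inl rfl)

end MinDegree

/-- A minimal triangle collection `C` with `m(C) < 15/8` on which Maker
wins the unbiased `T_C`-tournament game satisfies: `5 ≤ v(C) ≤ 7`, `e(C) = 2v(C) - 1`,
`δ(C) ≥ 3`, and `C` is not basic. -/
theorem minimal_collection_properties {V : Type*} [DecidableEq V] [Fintype V]
    (C : Finset (Sym2 V)) (hdiag : ∀ e ∈ C, ¬ e.IsDiag)
    (hcoll : IsTriangleCollection C)
    (hdens : MaxDensityLt C (15 / 8))
    (hwin : OMakerWin C HasCyclicTriangle 1 ∅ ∅)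
    (hmin : ∀ C' : Finset (Sym2 V), C' ⊂ C → IsTriangleCollection C' →
      ¬ OMakerWin C' HasCyclicTriangle 1 ∅ ∅) :
    (5 ≤ (support C).card ∧ (support C).card ≤ 7) ∧
    C.card = 2 * (support C).card - 1 ∧
    (∀ v ∈ support C, 3 ≤ degreeIn C v) ∧
    ¬ Basic C := by
  obtain ⟨hne, hle⟩ := hcoll.le_card_of_oMakerWin hwin
  have hv0 : 0 < (support C).card := by
    rw [Finset.card_pos]
    obtain ⟨e, he⟩ := hne
    exact ⟨e.out.1, mem_support.2 ⟨e, he, e.out_fst_mem⟩⟩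
  have hlt : 8 * C.card < 15 * (support C).card := by
    have h := hdens C subset_rfl hne
    rw [div_lt_iff₀ (by exact_mod_cast hv0)] at h
    have h' : (8 * C.card : ℝ) < 15 * (support C).card := by linarith
    exact_mod_cast h'
  have hchoose : C.card ≤ (support C).card.choose 2 := by
    rw [← Sym2.card_image_offDiag]
    refine Finset.card_le_card fun e he => ?_
    induction e with | h a b =>
    refine Finset.mem_image.2 ⟨(a, b), Finset.mem_offDiag.2
      ⟨mem_support.2 ⟨_, he, by simp⟩, mem_support.2 ⟨_, he, by simp⟩, ?_⟩, rfl⟩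
    simpa using hdiag _ he
  have h7 : (support C).card ≤ 7 := by omega
  have h5 : 5 ≤ (support C).card := by
    by_contra! h
    have key : ∀ n m : ℕ, 0 < n → n < 5 → 2 * n ≤ m + 1 → m ≤ n.choose 2 → False := by
      intro n m h0 h5 h1 h2
      interval_cases n <;> norm_num [Nat.choose] at h2 <;> omega
    exact key _ _ hv0 h hle hchoose
  refine ⟨⟨h5, h7⟩, by omega, fun v hv => ?_, fun h => h.answerable.not_oMakerWin hwin⟩
  by_contra! hdeg
  obtain ⟨e, he, hve⟩ := mem_support.1 hv
  obtain ⟨a, b, c, h, habc⟩ := hcoll.1 e he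
  obtain ⟨x, y, hT, -⟩ := TriSets.exists_of_mem_vertex ⟨a, b, c, h, rfl⟩ habc hve
  have hpq : s(v, x) ≠ s(v, y) := by
    rw [Ne, Sym2.congr_right]
    exact hT.2.1
  have hedges : ∀ e ∈ C, v ∈ e → e = s(v, x) ∨ e = s(v, y) := by
    classical
    intro e he hve
    by_contra! hcon
    have : ({e, s(v, x), s(v, y)} : Finset (Sym2 V)) ⊆ C.filter fun e => v ∈ e := by
      simp [Finset.insert_subset_iff, he, hve, hT.2.2.2.1, hT.2.2.2.2.2]
    have := Finset.card_le_card this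
    rw [Finset.card_eq_three.2 ⟨_, _, _, hcon.1, hcon.2, hpq, rfl⟩] at this
    rw [degreeIn] at hdeg
    convert absurd (this.trans_lt ?_) (lt_irrefl 3)
    convert hdeg
  have hD : ∀ e, e ∈ C.filter (fun e => v ∉ e) ↔ e ∈ C ∧ v ∉ e := fun e => Finset.mem_filter
  refine hmin (C.filter fun e => v ∉ e) ?_
    (hcoll.of_remove_vertex hT hedges hD (by omega)) ?_
  · exact Finset.filter_ssubset.2 ⟨_, he, not_not_intro hve⟩
  refine hwin.restrict (p := s(v, x)) (q := s(v, y)) ?_ hpq (by simp) (by simp) ?_ ?_ ?_ ?_ ?_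
    subset_rfl ?_
  · ext e
    have := hedges e
    have h1 := hT.2.2.2.1
    have h2 := hT.2.2.2.2.2
    rw [Finset.mem_insert, Finset.mem_insert, hD]
    refine ⟨by tauto, ?_⟩
    rintro (rfl | rfl | h)
    exacts [h1, h2, h.1]
  · intro t ht
    have key : ∀ e ∈ t, v ∈ e → s(v, x) ∈ t ∧ s(v, y) ∈ t := by
      intro e he hve
      obtain ⟨a, b, ⟨-, h2, -, h4, -, h6⟩, rfl⟩ := TriSets.exists_of_mem_vertex ht he hve
      have ha := hedges _ h4 (by simp)
      have hb := hedges _ h6 (by simp)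
      rw [Sym2.congr_right, Sym2.congr_right] at ha hb
      rcases ha with rfl | rfl <;> rcases hb with rfl | rfl
      · exact absurd rfl h2
      · simp [triEdges]
      · simp [triEdges]
      · exact absurd rfl h2
    exact ⟨fun h => (key _ h (by simp)).2, fun h => (key _ h (by simp)).1⟩
  all_goals simp [undirect]

end TournamentGame
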